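/- arXiv:math/0408217 — 2 statements merged into one kernel-verified Lean document; each statement's English description precedes it below -/
import Mathlib

section
/- Let A and B be star ℂ-algebras. Let E be a (B,A)-bimodule (left B-module and right A-module with (b·φ)·a = b·(φ·a)) equipped with a map ⟨·,·⟩_A : E × E → A that is additive in each argument and satisfies ⟨φ, ψ·a⟩_A = ⟨φ, ψ⟩_A · a, (⟨φ, ψ⟩_A)* = ⟨ψ, φ⟩_A, and ⟨φ, b·ψ⟩_A = ⟨b*·φ, ψ⟩_A for all φ, ψ ∈ E, a ∈ A, b ∈ B; assume ⟨·,·⟩_A is completely positive: for every k and every φ₁, …, φ_k ∈ E the matrix (⟨φ_i, φ_j⟩_A) lies in M_k(A)⁺. Let F be a right B-module with a map ⟨·,·⟩_B : F × F → B that is additive in each argument, satisfies ⟨x, y·b⟩_B = ⟨x, y⟩_B · b and (⟨x, y⟩_B)* = ⟨y, x⟩_B, and is completely positive in the same sense. Then for all n, N ∈ ℕ and all families x^α_i ∈ F and φ^α_i ∈ E (α = 1, …, n; i = 1, …, N), the n×n matrix with (α,β)-entry Σ_{i,j=1}^N ⟨φ^α_i, ⟨x^α_i, x^β_j⟩_B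 · φ^β_j⟩_A belongs to Mₙ(A)⁺. (This matrix is the Gram matrix (⟨Φ^α, Φ^β⟩) of the elements Φ^α = Σ_i x^α_i ⊗ φ^α_i of F ⊗_B E with respect to the inner product determined by ⟨x⊗φ, y⊗ψ⟩ = ⟨φ, ⟨x, y⟩_B · ψ⟩_A; hence that inner product on the internal tensor product is completely positive.) -/
open ComplexOrder

/-- A matrix `M ∈ Mₖ(D)` over a star ℂ-algebra `D` is a positive element: `0 ≤ Ω M`
for every positive ℂ-linear functional `Ω` on `Mₖ(D)`. -/
def MatPos {D : Type*} [NonUnitalRing D] [Module ℂ D] [StarRing D]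
    {k : ℕ} (M : Matrix (Fin k) (Fin k) D) : Prop :=
  ∀ Ω : Matrix (Fin k) (Fin k) D →ₗ[ℂ] ℂ,
    (∀ N : Matrix (Fin k) (Fin k) D, 0 ≤ Ω (star N * N)) → 0 ≤ Ω M

open ComplexStarModule in
/-- A real-linear functional is extended to a complex-linear one that agrees with it on
self-adjoint elements. -/
theorem exists_complexLinear_eq_on_selfAdjoint {R : Type*} [NonUnitalRing R] [StarRing R]
    [Module ℂ R] [StarModule ℂ R] (g : R →ₗ[ℝ] ℝ) :
    ∃ Ω : R →ₗ[ℂ] ℂ, ∀ a : R, IsSelfAdjoint a → Ω a = (g a : ℂ) := by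
  let f : Module.Dual ℝ R := g ∘ₗ (selfAdjoint.submodule ℝ R).subtype ∘ₗ realPart
  have hf : ∀ a : R, f a = g (ℜ a : R) := fun _ => rfl
  refine ⟨f.extendRCLike, fun a ha => ?_⟩
  have hI : f (Complex.I • a) = 0 := by
    rw [hf, realPart_I_smul, ha.imaginaryPart]
    simp
  rw [Module.Dual.extendRCLike_apply]
  change (f a : ℂ) - Complex.I * (f (Complex.I • a) : ℂ) = _
  rw [hI, hf, ha.coe_realPart]
  simp

/-- A self-adjoint element at which every positive complex-linear functional is nonnegative is a
real linear combination of squares `star a * a`. -/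
theorem mem_span_star_mul_self {R : Type*} [NonUnitalRing R] [StarRing R]
    [Module ℂ R] [StarModule ℂ R] {m : R} (hm : IsSelfAdjoint m)
    (hpos : ∀ Ω : R →ₗ[ℂ] ℂ, (∀ a, 0 ≤ Ω (star a * a)) → 0 ≤ Ω m) :
    m ∈ Submodule.span ℝ (Set.range fun a : R => star a * a) := by
  by_contra hmem
  obtain ⟨f, hfm, hf⟩ := Submodule.exists_le_ker_of_notMem hmem
  obtain ⟨Ω, hΩ⟩ := exists_complexLinear_eq_on_selfAdjoint f
  have hsq (a : R) : Ω (star a * a) = 0 := by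
    rw [hΩ _ (.star_mul_self a), LinearMap.mem_ker.1 (hf (Submodule.subset_span ⟨a, rfl⟩))]
    simp
  have h₁ := hpos Ω fun a => (hsq a).ge
  have h₂ := hpos (-Ω) fun a => by simp [hsq]
  rw [LinearMap.neg_apply, hΩ m hm, ← Complex.ofReal_neg, Complex.zero_le_real] at h₂
  rw [hΩ m hm, Complex.zero_le_real] at h₁
  exact hfm (by linarith)

/-- An additive real-valued map that is nonnegative on squares is real-linear on each ray spanned
by a square. -/
theorem map_real_smul_star_mul_self {R : Type*} [NonUnitalRing R] [StarRing R]
    [Module ℂ R] [SMulCommClass ℂ R R] [IsScalarTower ℂ R R] [StarModule ℂ R]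
    (T : R →+ ℝ) (hT : ∀ a, 0 ≤ T (star a * a)) (r : ℝ) (a : R) :
    T (r • (star a * a)) = r * T (star a * a) := by
  let h : ℝ →+ ℝ := T.comp (LinearMap.toSpanSingleton ℝ R (star a * a)).toAddMonoidHom
  have hh : ∀ s : ℝ, h s = T (s • (star a * a)) := fun _ => rfl
  have hnonneg : ∀ s : ℝ, 0 ≤ s → 0 ≤ h s := fun s hs => by
    have key := hT (Real.sqrt s • a)
    rwa [star_smul, star_trivial, smul_mul_smul_comm, Real.mul_self_sqrt hs] at key
  have hmono : Monotone h := fun s t hst => by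
    have := hnonneg (t - s) (sub_nonneg.2 hst)
    rw [map_sub] at this
    linarith
  have hcont : Continuous h :=
    MeasureTheory.Measure.AddMonoidHom.continuous_of_measurable h hmono.measurable
  simpa [hh] using map_real_smul h hcont r 1

/-- Positivity of a self-adjoint element, tested against complex-linear functionals, is also
detected by functionals that are merely additive. -/
theorem additive_nonneg_of_positive {R : Type*} [NonUnitalRing R] [StarRing R]
    [Module ℂ R] [SMulCommClass ℂ R R] [IsScalarTower ℂ R R] [StarModule ℂ R]
    {m : R} (hm : IsSelfAdjoint m)
    (hpos : ∀ Ω : R →ₗ[ℂ] ℂ, (∀ a, 0 ≤ Ω (star a * a)) → 0 ≤ Ω m)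
    (T : R →+ ℝ) (hT : ∀ a, 0 ≤ T (star a * a)) : 0 ≤ T m := by
  have hmem := mem_span_star_mul_self hm hpos
  let H := Submodule.span ℝ (Set.range fun a : R => star a * a)
  have hsmul : ∀ x ∈ H, ∀ r : ℝ, T (r • x) = r * T x := by
    intro x hx
    induction hx using Submodule.span_induction with
    | mem x hx =>
      obtain ⟨a, rfl⟩ := hx
      exact fun r => map_real_smul_star_mul_self T hT r a
    | zero => simp
    | add x y _ _ hx hy => intro r; rw [smul_add, map_add, map_add, hx, hy, mul_add]
    | smul s x _ hx => intro r; rw [smul_smul, hx, hx, mul_assoc]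
  let T₀ : H →ₗ[ℝ] ℝ :=
    { toFun := fun x => T x
      map_add' := fun x y => by simp
      map_smul' := fun r x => hsmul x x.2 r }
  obtain ⟨g, hg⟩ := T₀.exists_extend
  have hgT : ∀ x ∈ H, g x = T x := fun x hx => LinearMap.congr_fun hg ⟨x, hx⟩
  obtain ⟨Ω, hΩ⟩ := exists_complexLinear_eq_on_selfAdjoint g
  have key := hpos Ω fun a => by
    rw [hΩ _ (.star_mul_self a), hgT _ (Submodule.subset_span ⟨a, rfl⟩), Complex.zero_le_real]
    exact hT a
  rwa [hΩ m hm, Complex.zero_le_real, hgT m hmem] at key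

/-- The complex-valued version of `additive_nonneg_of_positive`. -/
theorem additive_complex_nonneg_of_positive {R : Type*} [NonUnitalRing R] [StarRing R]
    [Module ℂ R] [SMulCommClass ℂ R R] [IsScalarTower ℂ R R] [StarModule ℂ R]
    {m : R} (hm : IsSelfAdjoint m)
    (hpos : ∀ Ω : R →ₗ[ℂ] ℂ, (∀ a, 0 ≤ Ω (star a * a)) → 0 ≤ Ω m)
    (T : R →+ ℂ) (hT : ∀ a, 0 ≤ T (star a * a)) : 0 ≤ T m := by
  have him (a : R) : (T (star a * a)).im = 0 := (Complex.nonneg_iff.1 (hT a)).2.symm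
  have hre := additive_nonneg_of_positive hm hpos (Complex.reAddGroupHom.comp T)
    fun a => (Complex.nonneg_iff.1 (hT a)).1
  have him₁ := additive_nonneg_of_positive hm hpos (Complex.imAddGroupHom.comp T)
    fun a => (him a).ge
  have him₂ := additive_nonneg_of_positive hm hpos (-(Complex.imAddGroupHom.comp T))
    fun a => by simp [him]
  exact Complex.nonneg_iff.2 ⟨hre, le_antisymm him₁ (neg_nonneg.1 him₂)⟩

/-- The additive map `M ↦ (∑ i j, ⟨φ α i, M (α, i) (β, j) • φ β j⟩)` from matrices over `B` to
matrices over `A`. -/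
def gramCompression {A B E : Type*} [AddCommGroup A] [AddCommGroup B] [AddCommGroup E]
    (act : B →+ E →+ E) (inn : E →+ E →+ A) {n N : ℕ} (φ : Fin n → Fin N → E) :
    Matrix (Fin (n * N)) (Fin (n * N)) B →+ Matrix (Fin n) (Fin n) A where
  toFun M := Matrix.of fun α β => ∑ i, ∑ j, inn (φ α i)
    (act (M (finProdFinEquiv (α, i)) (finProdFinEquiv (β, j))) (φ β j))
  map_zero' := by ext; simp
  map_add' M M' := by ext; simp [Finset.sum_add_distrib]

/-- The compression of a square `star C * C` is a sum of Gram matrices, one for each row of `C`. -/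
theorem gramCompression_star_mul_self {A B E : Type*} [AddCommGroup A] [NonUnitalRing B]
    [StarRing B] [AddCommGroup E] (act : B →+ E →+ E) (inn : E →+ E →+ A)
    (act_mul : ∀ b b' φ, act (b * b') φ = act b (act b' φ))
    (inn_act : ∀ φ ψ b, inn φ (act b ψ) = inn (act (star b) φ) ψ)
    {n N : ℕ} (φ : Fin n → Fin N → E) (C : Matrix (Fin (n * N)) (Fin (n * N)) B) :
    gramCompression act inn φ (star C * C) = ∑ r, Matrix.of fun α β =>
      inn (∑ i, act (C r (finProdFinEquiv (α, i))) (φ α i))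
        (∑ j, act (C r (finProdFinEquiv (β, j))) (φ β j)) := by
  ext α β
  have hentry (i j : Fin N) :
      inn (φ α i) (act ((star C * C) (finProdFinEquiv (α, i)) (finProdFinEquiv (β, j))) (φ β j)) =
        ∑ r, inn (act (C r (finProdFinEquiv (α, i))) (φ α i))
          (act (C r (finProdFinEquiv (β, j))) (φ β j)) := by
    rw [Matrix.mul_apply, map_sum, AddMonoidHom.finsetSum_apply, map_sum]
    refine Finset.sum_congr rfl fun r _ => ?_
    rw [act_mul, inn_act, Matrix.star_apply, star_star]
  simp only [gramCompression, AddMonoidHom.coe_mk, ZeroHom.coe_mk, Matrix.of_apply,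
    Matrix.sum_apply, hentry, map_sum, AddMonoidHom.finsetSum_apply]
  rw [← Finset.sum_comm_cycle, Finset.sum_comm]

theorem stmt_12 {A B E F : Type*}
    [NonUnitalRing A] [Module ℂ A] [SMulCommClass ℂ A A] [IsScalarTower ℂ A A]
    [StarRing A] [StarModule ℂ A]
    [NonUnitalRing B] [Module ℂ B] [SMulCommClass ℂ B B] [IsScalarTower ℂ B B]
    [StarRing B] [StarModule ℂ B]
    [AddCommGroup E] [AddCommGroup F]
    -- (B,A)-bimodule structure on E
    (actB : B → E → E) (actA : E → A → E)
    (hactB_addl : ∀ (b b' : B) (φ : E), actB (b + b') φ = actB b φ + actB b' φ)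
    (hactB_addr : ∀ (b : B) (φ φ' : E), actB b (φ + φ') = actB b φ + actB b φ')
    (hactB_mul : ∀ (b b' : B) (φ : E), actB (b * b') φ = actB b (actB b' φ))
    (hactA_addl : ∀ (φ φ' : E) (a : A), actA (φ + φ') a = actA φ a + actA φ' a)
    (hactA_addr : ∀ (φ : E) (a a' : A), actA φ (a + a') = actA φ a + actA φ a')
    (hactA_mul : ∀ (φ : E) (a a' : A), actA φ (a * a') = actA (actA φ a) a')
    (hbimod : ∀ (b : B) (φ : E) (a : A), actA (actB b φ) a = actB b (actA φ a))
    -- the A-valued inner product on E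
    (innA : E → E → A)
    (hinnA_addl : ∀ φ φ' ψ : E, innA (φ + φ') ψ = innA φ ψ + innA φ' ψ)
    (hinnA_addr : ∀ φ ψ ψ' : E, innA φ (ψ + ψ') = innA φ ψ + innA φ ψ')
    (hinnA_actA : ∀ (φ ψ : E) (a : A), innA φ (actA ψ a) = innA φ ψ * a)
    (hinnA_star : ∀ φ ψ : E, star (innA φ ψ) = innA ψ φ)
    (hinnA_actB : ∀ (φ ψ : E) (b : B), innA φ (actB b ψ) = innA (actB (star b) φ) ψ)
    (hinnA_cp : ∀ (k : ℕ) (φ : Fin k → E),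
      MatPos (Matrix.of fun i j : Fin k => innA (φ i) (φ j)))
    -- right B-module structure on F
    (actFB : F → B → F)
    (hactFB_addl : ∀ (x x' : F) (b : B), actFB (x + x') b = actFB x b + actFB x' b)
    (hactFB_addr : ∀ (x : F) (b b' : B), actFB x (b + b') = actFB x b + actFB x b')
    (hactFB_mul : ∀ (x : F) (b b' : B), actFB x (b * b') = actFB (actFB x b) b')
    -- the B-valued inner product on F
    (innB : F → F → B)
    (hinnB_addl : ∀ x x' y : F, innB (x + x') y = innB x y + innB x' y)
    (hinnB_addr : ∀ x y y' : F, innB x (y + y') = innB x y + innB x y')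
    (hinnB_act : ∀ (x y : F) (b : B), innB x (actFB y b) = innB x y * b)
    (hinnB_star : ∀ x y : F, star (innB x y) = innB y x)
    (hinnB_cp : ∀ (k : ℕ) (x : Fin k → F),
      MatPos (Matrix.of fun i j : Fin k => innB (x i) (x j))) :
    ∀ (n N : ℕ) (x : Fin n → Fin N → F) (φ : Fin n → Fin N → E),
      MatPos (Matrix.of fun α β : Fin n =>
        ∑ i, ∑ j, innA (φ α i) (actB (innB (x α i) (x β j)) (φ β j))) := by
  intro n N x φ Ω hΩ
  let act : B →+ E →+ E := AddMonoidHom.mk'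
    (fun b => AddMonoidHom.mk' (actB b) (hactB_addr b)) fun b b' => by
      ext ψ; exact hactB_addl b b' ψ
  let inn : E →+ E →+ A := AddMonoidHom.mk'
    (fun ψ => AddMonoidHom.mk' (innA ψ) (hinnA_addr ψ)) fun ψ ψ' => by
      ext χ; exact hinnA_addl ψ ψ' χ
  let y : Fin (n * N) → F := fun p => x (finProdFinEquiv.symm p).1 (finProdFinEquiv.symm p).2
  let M : Matrix (Fin (n * N)) (Fin (n * N)) B := Matrix.of fun p q => innB (y p) (y q)
  have hM : IsSelfAdjoint M := by
    ext p q
    exact hinnB_star (y q) (y p)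
  have key := additive_complex_nonneg_of_positive hM (hinnB_cp _ y)
    (Ω.toAddMonoidHom.comp (gramCompression act inn φ)) fun C => by
      rw [AddMonoidHom.comp_apply,
        gramCompression_star_mul_self act inn hactB_mul hinnA_actB φ C, map_sum]
      exact Finset.sum_nonneg fun r _ => hinnA_cp n
        (fun α => ∑ i, act (C r (finProdFinEquiv (α, i))) (φ α i)) Ω hΩ
  convert key using 1
  change _ = Ω (gramCompression act inn φ M)
  congr 1
  ext α β
  simp only [gramCompression, AddMonoidHom.coe_mk, ZeroHom.coe_mk, Matrix.of_apply,
    Equiv.symm_apply_apply, M, y]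
  rfl
end

section
/- Let A and B be unital rings, and let E be a (B,A)-bimodule on which the unit of B acts as the identity. Suppose given maps ⟨·,·⟩_A : E × E → A, additive in each argument and satisfying ⟨x, y·a⟩_A = ⟨x, y⟩_A · a for all x, y ∈ E and a ∈ A, and ⟨·,·⟩_B : E × E → B satisfying the compatibility ⟨x, y⟩_B · z = x · ⟨y, z⟩_A for all x, y, z ∈ E. Assume ⟨·,·⟩_B is full in the sense that there exist finitely many ξ₁, …, ξ_n, η₁, …, η_n ∈ E with Σ_{i=1}^n ⟨ξ_i, η_i⟩_B = 1_B. Then every x ∈ E satisfies x = Σ_{i=1}^n ξ_i · ⟨η_i, x⟩_A; consequently the ξ_i together with the maps ⟨η_i, ·⟩_A form a finite dual basis, so E is a finitely generated projective right A-module. -/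
/-- A module with a finite dual basis is finitely generated and projective. -/
theorem finite_and_projective_of_dualBasis {R M ι : Type*} [Semiring R] [AddCommMonoid M]
    [Module R M] [Fintype ι] (v : ι → M) (f : ι → M →ₗ[R] R)
    (h : ∀ x, ∑ i, f i x • v i = x) :
    Module.Finite R M ∧ Module.Projective R M := by
  have hsplit : Fintype.linearCombination R v ∘ₗ LinearMap.pi f = LinearMap.id :=
    LinearMap.ext fun x => by simpa [Fintype.linearCombination_apply] using h x
  exact ⟨Module.Finite.of_surjective (Fintype.linearCombination R v)
      fun x => ⟨LinearMap.pi f x, LinearMap.congr_fun hsplit x⟩,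
    Module.Projective.of_split (LinearMap.pi f) (Fintype.linearCombination R v) hsplit⟩

theorem stmt_17 {A B E : Type*} [Ring A] [Ring B]
    [AddCommGroup E] [Module B E] [Module Aᵐᵒᵖ E] [SMulCommClass B Aᵐᵒᵖ E]
    (innA : E → E → A)
    (hinnA_addl : ∀ x x' y : E, innA (x + x') y = innA x y + innA x' y)
    (hinnA_addr : ∀ x y y' : E, innA x (y + y') = innA x y + innA x y')
    (hinnA_smul : ∀ (x y : E) (a : A),
      innA x (MulOpposite.op a • y) = innA x y * a)
    (innB : E → E → B)
    (hcompat : ∀ x y z : E, innB x y • z = MulOpposite.op (innA y z) • x)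
    (n : ℕ) (ξ η : Fin n → E)
    (hfull : ∑ i, innB (ξ i) (η i) = 1) :
    (∀ x : E, x = ∑ i, MulOpposite.op (innA (η i) x) • ξ i) ∧
    Module.Finite Aᵐᵒᵖ E ∧ Module.Projective Aᵐᵒᵖ E := by
  have expand : ∀ x : E, x = ∑ i, MulOpposite.op (innA (η i) x) • ξ i := fun x => by
    simp_rw [← hcompat, ← Finset.sum_smul, hfull, one_smul]
  let f : Fin n → E →ₗ[Aᵐᵒᵖ] Aᵐᵒᵖ := fun i =>
    { toFun := fun x => MulOpposite.op (innA (η i) x)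
      map_add' := fun x y => by rw [hinnA_addr, MulOpposite.op_add]
      map_smul' := fun r x => by
        rw [← MulOpposite.op_unop r, hinnA_smul, MulOpposite.op_mul]
        rfl }
  exact ⟨expand, finite_and_projective_of_dualBasis ξ f fun x => (expand x).symm⟩
end
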